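/- arXiv:1509.05480 — 2 statements merged into one kernel-verified Lean document; each statement's English description precedes it below -/
import Mathlib

section
/- Let A (m×n) and B (n×m) be entrywise positive real matrices, and let (x*, y*) be the unique Nash equilibrium of the corresponding positive unit-sphere game. Define the Cournot adjustment sequence by choosing any entrywise positive unit vectors x⁰ ∈ ℝ^m, y⁰ ∈ ℝⁿ and setting x^{t+1} = Ay^t/‖Ay^t‖₂ and y^{t+1} = Bx^t/‖Bx^t‖₂. Then there exist c > 0 and r ∈ (0,1) such that ‖x^t − x*‖₂ ≤ c·r^t and ‖y^t − y*‖₂ ≤ c·r^t for all t; in particular (x^t, y^t) converges to (x*, y*) with exponentially (linearly) decreasing error. -/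
open Matrix Finset

/-- Any two quotients of the entries of `w` by those of `y` differ by a factor of at most
`1 + e`. -/
def RatioOscLE {ι : Type*} (w y : ι → ℝ) (e : ℝ) : Prop :=
  ∀ j k, w j * y k ≤ (1 + e) * (w k * y j)

theorem RatioOscLE.smul {ι : Type*} {w y : ι → ℝ} {e c : ℝ} (h : RatioOscLE w y e)
    (hc : 0 ≤ c) : RatioOscLE (c • w) y e := by
  intro j k
  have := mul_le_mul_of_nonneg_left (h j k) hc
  simp only [Pi.smul_apply, smul_eq_mul]
  linarith

theorem RatioOscLE.mono {ι : Type*} {w y : ι → ℝ} {e e' : ℝ} (h : RatioOscLE w y e)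
    (hw : ∀ i, 0 < w i) (hy : ∀ i, 0 < y i) (he : e ≤ e') : RatioOscLE w y e' := by
  intro j k
  have := mul_le_mul_of_nonneg_right he (mul_pos (hw k) (hy j)).le
  linarith [h j k]

theorem exists_ratioOscLE {ι : Type*} [Finite ι] {w y : ι → ℝ}
    (hw : ∀ i, 0 < w i) (hy : ∀ i, 0 < y i) : ∃ e > 0, RatioOscLE w y e := by
  obtain ⟨C, hC⟩ := Finite.bddAbove_range
    (fun p : ι × ι => w p.1 * y p.2 / (w p.2 * y p.1))
  refine ⟨max C 1, by positivity, fun j k => ?_⟩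
  have h := hC ⟨(j, k), rfl⟩
  have hpos := mul_pos (hw k) (hy j)
  rw [← div_le_iff₀ hpos]
  exact h.trans ((le_max_left C 1).trans (by linarith))

theorem exists_pos_forall_le {ι : Type*} [Finite ι] {f : ι → ℝ} (hf : ∀ i, 0 < f i) :
    ∃ δ > 0, ∀ i, δ ≤ f i := by
  rcases isEmpty_or_nonempty ι with h | h
  · exact ⟨1, one_pos, fun i => h.elim i⟩
  · obtain ⟨i, hi⟩ := Finite.exists_min f
    exact ⟨f i, hf i, hi⟩

/-- A positive matrix sending `y` to `l • x` contracts the oscillation of ratios. -/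
theorem RatioOscLE.mulVec {ι κ : Type*} [Fintype κ]
    {A : Matrix ι κ ℝ} (hA : ∀ i j, 0 < A i j) {x : ι → ℝ} {y w : κ → ℝ} {l δ e : ℝ}
    (hx : ∀ i, 0 < x i) (hy : ∀ j, 0 < y j) (hw : ∀ j, 0 < w j) (hl : 0 < l)
    (hAy : A *ᵥ y = l • x) (hδ : ∀ i j, δ ≤ A i j * y j / (l * x i)) (hδ1 : δ ≤ 1)
    (he : 0 ≤ e) (h : RatioOscLE w y e) :
    RatioOscLE (A *ᵥ w) x ((1 - δ) * e) := by
  have hrow (i) : ∑ j, A i j * y j = l * x i := congrFun hAy i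
  intro i k
  have : Nonempty κ := by
    by_contra hκ
    rw [not_nonempty_iff] at hκ
    have := hrow i
    simp only [univ_eq_empty, sum_empty] at this
    exact (mul_pos hl (hx i)).ne this
  obtain ⟨q, hq⟩ := Finite.exists_min (fun j => w j / y j)
  set μ := w q / y q with hμ
  have hμ0 : 0 < μ := div_pos (hw q) (hy q)
  have hwq : w q = μ * y q := by rw [hμ, div_mul_cancel₀ _ (hy q).ne']
  have hlow (j) : μ * y j ≤ w j := (le_div_iff₀ (hy j)).1 (hq j)
  have hup (j) : w j ≤ (1 + e) * μ * y j := by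
    have := h j q
    rw [hwq] at this
    refine le_of_mul_le_mul_right ?_ (hy q)
    linarith
  have hupper : (A *ᵥ w) i ≤ (1 + (1 - δ) * e) * (μ * (l * x i)) := by
    have hs := single_le_sum (f := fun j => A i j * ((1 + e) * μ * y j - w j))
      (fun j _ => mul_nonneg (hA i j).le (sub_nonneg.2 (hup j))) (mem_univ q)
    have hsum : ∑ j, A i j * ((1 + e) * μ * y j - w j)
        = (1 + e) * μ * (l * x i) - (A *ᵥ w) i := by
      rw [← hrow, mul_sum, Matrix.mulVec, dotProduct, ← sum_sub_distrib]
      exact sum_congr rfl fun j _ => by ring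
    rw [hsum] at hs
    simp only [hwq] at hs
    have hd := (le_div_iff₀ (mul_pos hl (hx i))).1 (hδ i q)
    have := mul_le_mul_of_nonneg_left hd (mul_nonneg he hμ0.le)
    linarith
  have hlower : μ * (l * x k) ≤ (A *ᵥ w) k := by
    rw [← hrow, mul_sum]
    refine sum_le_sum fun j _ => ?_
    have := mul_le_mul_of_nonneg_left (hlow j) (hA k j).le
    linarith
  have he' : 0 ≤ (1 - δ) * e := mul_nonneg (sub_nonneg.2 hδ1) he
  calc (A *ᵥ w) i * x k ≤ (1 + (1 - δ) * e) * (μ * (l * x i)) * x k :=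
        mul_le_mul_of_nonneg_right hupper (hx k).le
    _ = (1 + (1 - δ) * e) * (μ * (l * x k) * x i) := by ring
    _ ≤ (1 + (1 - δ) * e) * ((A *ᵥ w) k * x i) := by
        have := hx i
        gcongr

theorem RatioOscLE.sqrt_sum_sub_sq_le {ι : Type*} [Fintype ι] {w y : ι → ℝ} {e : ℝ}
    (h : RatioOscLE w y e) (he : 0 ≤ e) (hw : ∀ i, 0 < w i) (hy : ∀ i, 0 < y i)
    (hw1 : ∑ i, w i ^ 2 = 1) (hy1 : ∑ i, y i ^ 2 = 1) :
    Real.sqrt (∑ i, (w i - y i) ^ 2) ≤ e := by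
  have hsq (j k) : w j ^ 2 * y k ^ 2 ≤ (1 + e) ^ 2 * (w k ^ 2 * y j ^ 2) := by
    have := pow_le_pow_left₀ (mul_pos (hw j) (hy k)).le (h j k) 2
    linarith
  have h1 (i) : w i ≤ (1 + e) * y i := by
    have hs := sum_le_sum fun k (_ : k ∈ univ) => hsq i k
    rw [← mul_sum, ← mul_sum, ← sum_mul, hw1, hy1] at hs
    have := hy i
    refine (sq_le_sq₀ (hw i).le (by positivity)).1 ?_
    linarith
  have h2 (k) : y k ≤ (1 + e) * w k := by
    have hs := sum_le_sum fun j (_ : j ∈ univ) => hsq j k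
    rw [← sum_mul, ← mul_sum, ← mul_sum, hw1, hy1] at hs
    have := hw k
    refine (sq_le_sq₀ (hy k).le (by positivity)).1 ?_
    linarith
  rw [Real.sqrt_le_left he]
  calc ∑ i, (w i - y i) ^ 2 ≤ ∑ i, e ^ 2 * y i ^ 2 := by
        refine sum_le_sum fun i _ => ?_
        rw [← mul_pow]
        refine sq_le_sq' ?_ (by linarith [h1 i])
        rcases le_total (w i) (y i) with hle | hle
        · linarith [h2 i, mul_le_mul_of_nonneg_left hle he]
        · linarith [mul_nonneg he (hy i).le]
    _ = e ^ 2 := by rw [← mul_sum, hy1, mul_one]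

theorem sum_inv_sqrt_smul_sq {ι : Type*} [Fintype ι] {v : ι → ℝ} (hv : 0 < ∑ i, v i ^ 2) :
    ∑ i, ((Real.sqrt (∑ i, v i ^ 2))⁻¹ • v) i ^ 2 = 1 := by
  simp only [Pi.smul_apply, smul_eq_mul, mul_pow, ← mul_sum, inv_pow, Real.sq_sqrt hv.le]
  exact inv_mul_cancel₀ hv.ne'

/-- A unit vector maximizing `v ⬝ᵥ ·` over the nonnegative unit sphere is the normalization
of the nonnegative vector `v`. -/
theorem eq_sqrt_smul_of_forall_dotProduct_le {ι : Type*} [Fintype ι] {v x : ι → ℝ}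
    (hv : ∀ i, 0 ≤ v i) (hv0 : 0 < ∑ i, v i ^ 2) (hx : ∑ i, x i ^ 2 = 1)
    (h : ∀ x' : ι → ℝ, (∀ i, 0 ≤ x' i) → ∑ i, x' i ^ 2 = 1 → x' ⬝ᵥ v ≤ x ⬝ᵥ v) :
    v = Real.sqrt (∑ i, v i ^ 2) • x := by
  set N := Real.sqrt (∑ i, v i ^ 2) with hN
  have hN0 : 0 < N := Real.sqrt_pos.2 hv0
  have hN2 : N ^ 2 = ∑ i, v i ^ 2 := Real.sq_sqrt hv0.le
  have hle := h (N⁻¹ • v) (fun i => mul_nonneg (inv_nonneg.2 hN0.le) (hv i))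
    (sum_inv_sqrt_smul_sq hv0)
  have hvv : v ⬝ᵥ v = N ^ 2 := by
    rw [hN2, dotProduct]
    exact sum_congr rfl fun i _ => (sq _).symm
  have hdot : N ≤ x ⬝ᵥ v := by
    rw [smul_dotProduct, hvv, smul_eq_mul, sq, inv_mul_cancel_left₀ hN0.ne'] at hle
    exact hle
  have hsum : ∑ i, (v i - N * x i) ^ 2 = 2 * N * (N - x ⬝ᵥ v) := by
    calc ∑ i, (v i - N * x i) ^ 2
        = ∑ i, v i ^ 2 - 2 * N * (x ⬝ᵥ v) + N ^ 2 * ∑ i, x i ^ 2 := by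
          rw [dotProduct, mul_sum, mul_sum, ← sum_sub_distrib, ← sum_add_distrib]
          exact sum_congr rfl fun i _ => by ring
      _ = _ := by rw [← hN2, hx]; ring
  have hzero : ∑ i, (v i - N * x i) ^ 2 = 0 :=
    le_antisymm (hsum ▸ mul_nonpos_of_nonneg_of_nonpos (by positivity) (by linarith))
      (sum_nonneg fun i _ => sq_nonneg _)
  funext i
  have := (sum_eq_zero_iff_of_nonneg fun i _ => sq_nonneg (v i - N * x i)).1 hzero i (mem_univ i)
  exact sub_eq_zero.1 (pow_eq_zero_iff two_ne_zero |>.1 this)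

theorem mulVec_pos_of_pos {ι κ : Type*} [Fintype κ] {A : Matrix ι κ ℝ}
    (hA : ∀ i j, 0 < A i j) {y : κ → ℝ} (hy : ∀ j, 0 ≤ y j) (hy1 : ∑ j, y j ^ 2 = 1) (i : ι) :
    0 < (A *ᵥ y) i := by
  obtain ⟨j, -, hj⟩ := exists_ne_zero_of_sum_ne_zero (hy1.trans_ne one_ne_zero)
  have hj0 : 0 < y j := (hy j).lt_of_ne' fun h => hj (by simp [h])
  exact sum_pos' (fun j _ => mul_nonneg (hA i j).le (hy j))
    ⟨j, mem_univ j, mul_pos (hA i j) hj0⟩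

theorem sum_sq_pos_of_pos {ι : Type*} [Fintype ι] {v x : ι → ℝ} (hv : ∀ i, 0 < v i)
    (hx : ∑ i, x i ^ 2 = 1) : 0 < ∑ i, v i ^ 2 := by
  obtain ⟨i, -, -⟩ := exists_ne_zero_of_sum_ne_zero (hx.trans_ne one_ne_zero)
  exact sum_pos (fun i _ => pow_pos (hv i) 2) ⟨i, mem_univ i⟩

/-- In a positive unit-sphere game, a best response `x` to `y` is positive and proportional
to `A *ᵥ y`. -/
theorem exists_pos_mulVec_eq_smul {ι κ : Type*} [Fintype ι] [Fintype κ] {A : Matrix ι κ ℝ}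
    (hA : ∀ i j, 0 < A i j) {x : ι → ℝ} {y : κ → ℝ} (hy : ∀ j, 0 ≤ y j)
    (hx1 : ∑ i, x i ^ 2 = 1) (hy1 : ∑ j, y j ^ 2 = 1)
    (h : ∀ x' : ι → ℝ, (∀ i, 0 ≤ x' i) → ∑ i, x' i ^ 2 = 1 → x' ⬝ᵥ A *ᵥ y ≤ x ⬝ᵥ A *ᵥ y) :
    ∃ l > (0 : ℝ), A *ᵥ y = l • x ∧ ∀ i, 0 < x i := by
  have hpos := mulVec_pos_of_pos hA hy hy1
  have hsum := sum_sq_pos_of_pos hpos hx1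
  have heq := eq_sqrt_smul_of_forall_dotProduct_le (fun i => (hpos i).le) hsum hx1 h
  have hl := Real.sqrt_pos.2 hsum
  refine ⟨_, hl, heq, fun i => ?_⟩
  have := hpos i
  rw [heq] at this
  exact pos_of_mul_pos_right this hl.le

/-- Ratio oscillation bound for one normalized best-response step. -/
theorem ratioOscLE_normalized_mulVec {ι κ : Type*} [Fintype ι] [Fintype κ]
    {A : Matrix ι κ ℝ} (hA : ∀ i j, 0 < A i j) {x : ι → ℝ} {y w : κ → ℝ} {l δ e : ℝ}
    (hx : ∀ i, 0 < x i) (hy : ∀ j, 0 < y j) (hw : ∀ j, 0 < w j) (hl : 0 < l)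
    (hx1 : ∑ i, x i ^ 2 = 1) (hw1 : ∑ j, w j ^ 2 = 1)
    (hAy : A *ᵥ y = l • x) (hδ : ∀ i j, δ ≤ A i j * y j / (l * x i)) (hδ1 : δ ≤ 1)
    (he : 0 ≤ e) (h : RatioOscLE w y e) {z : ι → ℝ}
    (hz : z = (Real.sqrt (∑ i, (A *ᵥ w) i ^ 2))⁻¹ • A *ᵥ w) :
    (∀ i, 0 < z i) ∧ ∑ i, z i ^ 2 = 1 ∧ RatioOscLE z x ((1 - δ) * e) := by
  have hpos := mulVec_pos_of_pos hA (fun j => (hw j).le) hw1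
  have hsum := sum_sq_pos_of_pos hpos hx1
  have hc := inv_pos.2 (Real.sqrt_pos.2 hsum)
  subst hz
  exact ⟨fun i => mul_pos hc (hpos i), sum_inv_sqrt_smul_sq hsum,
    (h.mulVec hA hx hy hw hl hAy hδ hδ1 he).smul hc.le⟩

/-- in a positive unit-sphere game with unique Nash equilibrium
`(x*, y*)`, the Cournot adjustment sequence started from any entrywise positive
unit vectors `x⁰, y⁰`, with `x^{t+1} = Ay^t/‖Ay^t‖₂` and `y^{t+1} = Bx^t/‖Bx^t‖₂`,
converges to `(x*, y*)` with exponentially (linearly) decreasing error: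
there are `c > 0` and `r ∈ (0,1)` with `‖x^t − x*‖₂ ≤ c·r^t` and
`‖y^t − y*‖₂ ≤ c·r^t` for all `t`. -/
theorem pusg_cournot_adjustment_converges {m n : ℕ}
    (A : Matrix (Fin m) (Fin n) ℝ) (B : Matrix (Fin n) (Fin m) ℝ)
    (hA : ∀ i j, 0 < A i j) (hB : ∀ j i, 0 < B j i)
    (xs : Fin m → ℝ) (ys : Fin n → ℝ)
    (hxsnn : ∀ i, 0 ≤ xs i) (hysnn : ∀ j, 0 ≤ ys j)
    (hxsunit : ∑ i, xs i ^ 2 = 1) (hysunit : ∑ j, ys j ^ 2 = 1)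
    (hNE1 : ∀ x' : Fin m → ℝ, (∀ i, 0 ≤ x' i) → ∑ i, x' i ^ 2 = 1 →
      x' ⬝ᵥ A.mulVec ys ≤ xs ⬝ᵥ A.mulVec ys)
    (hNE2 : ∀ y' : Fin n → ℝ, (∀ j, 0 ≤ y' j) → ∑ j, y' j ^ 2 = 1 →
      y' ⬝ᵥ B.mulVec xs ≤ ys ⬝ᵥ B.mulVec xs)
    (X : ℕ → Fin m → ℝ) (Y : ℕ → Fin n → ℝ)
    (hX0pos : ∀ i, 0 < X 0 i) (hY0pos : ∀ j, 0 < Y 0 j)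
    (hX0unit : ∑ i, X 0 i ^ 2 = 1) (hY0unit : ∑ j, Y 0 j ^ 2 = 1)
    (hXstep : ∀ t, X (t + 1) =
      (Real.sqrt (∑ i, A.mulVec (Y t) i ^ 2))⁻¹ • A.mulVec (Y t))
    (hYstep : ∀ t, Y (t + 1) =
      (Real.sqrt (∑ j, B.mulVec (X t) j ^ 2))⁻¹ • B.mulVec (X t)) :
    ∃ c > (0 : ℝ), ∃ r ∈ Set.Ioo (0 : ℝ) 1, ∀ t,
      Real.sqrt (∑ i, (X t i - xs i) ^ 2) ≤ c * r ^ t ∧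
      Real.sqrt (∑ j, (Y t j - ys j) ^ 2) ≤ c * r ^ t := by
  obtain ⟨l, hl, hAy, hxs⟩ := exists_pos_mulVec_eq_smul hA hysnn hxsunit hysunit hNE1
  obtain ⟨μ, hμ, hBx, hys⟩ := exists_pos_mulVec_eq_smul hB hxsnn hysunit hxsunit hNE2
  obtain ⟨δ₁, hδ₁, hδA⟩ := exists_pos_forall_le
    (f := fun p : Fin m × Fin n => A p.1 p.2 * ys p.2 / (l * xs p.1))
    fun p => div_pos (mul_pos (hA _ _) (hys _)) (mul_pos hl (hxs _))
  obtain ⟨δ₂, hδ₂, hδB⟩ := exists_pos_forall_le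
    (f := fun p : Fin n × Fin m => B p.1 p.2 * xs p.2 / (μ * ys p.1))
    fun p => div_pos (mul_pos (hB _ _) (hxs _)) (mul_pos hμ (hys _))
  obtain ⟨e₁, he₁, hX0⟩ := exists_ratioOscLE hX0pos hxs
  obtain ⟨e₂, he₂, hY0⟩ := exists_ratioOscLE hY0pos hys
  obtain ⟨δ, hδ, hδle⟩ : ∃ δ > 0, δ ≤ δ₁ ∧ δ ≤ δ₂ ∧ δ ≤ (1 / 2 : ℝ) :=
    ⟨min δ₁ (min δ₂ (1 / 2)), by positivity, min_le_left _ _,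
      (min_le_right _ _).trans (min_le_left _ _), (min_le_right _ _).trans (min_le_right _ _)⟩
  obtain ⟨hδ1, hδ2, hδ3⟩ := hδle
  have hr : 0 < 1 - δ := by linarith
  have hc : 0 < max e₁ e₂ := he₁.trans_le (le_max_left _ _)
  have key (t : ℕ) :
      ((∀ i, 0 < X t i) ∧ ∑ i, X t i ^ 2 = 1 ∧ RatioOscLE (X t) xs (max e₁ e₂ * (1 - δ) ^ t)) ∧
      ((∀ j, 0 < Y t j) ∧ ∑ j, Y t j ^ 2 = 1 ∧
        RatioOscLE (Y t) ys (max e₁ e₂ * (1 - δ) ^ t)) := by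
    induction t with
    | zero =>
      rw [pow_zero, mul_one]
      exact ⟨⟨hX0pos, hX0unit, hX0.mono hX0pos hxs (le_max_left _ _)⟩,
        hY0pos, hY0unit, hY0.mono hY0pos hys (le_max_right _ _)⟩
    | succ t ih =>
      obtain ⟨⟨hXp, hX1, hXr⟩, hYp, hY1, hYr⟩ := ih
      have he : 0 ≤ max e₁ e₂ * (1 - δ) ^ t := by positivity
      have hpow : max e₁ e₂ * (1 - δ) ^ (t + 1) = (1 - δ) * (max e₁ e₂ * (1 - δ) ^ t) := by ring
      rw [hpow]
      exact ⟨ratioOscLE_normalized_mulVec hA hxs hys hYp hl hxsunit hY1 hAy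
          (fun i j => hδ1.trans (hδA (i, j))) (by linarith) he hYr (hXstep t),
        ratioOscLE_normalized_mulVec hB hys hxs hXp hμ hysunit hX1 hBx
          (fun j i => hδ2.trans (hδB (j, i))) (by linarith) he hXr (hYstep t)⟩
  refine ⟨max e₁ e₂, hc, 1 - δ, ⟨hr, by linarith⟩, fun t => ?_⟩
  obtain ⟨⟨hXp, hX1, hXr⟩, hYp, hY1, hYr⟩ := key t
  have he : 0 ≤ max e₁ e₂ * (1 - δ) ^ t := by positivity
  exact ⟨hXr.sqrt_sum_sub_sq_le he hXp hxs hX1 hxsunit,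
    hYr.sqrt_sum_sub_sq_le he hYp hys hY1 hysunit⟩
end

section
/- Let m ≥ 2 and let (A¹, …, A^m) be a Markov m-player positive unit-sphere game (normalized so that each fiber sum equals 1) such that δ_k > (m − 2)/(m − 1) for every player k, where δ_k = min over subsets V ⊆ [n_k] of [ min_{(i_j)_{j≠k}} Σ_{i_k ∈ V} A^k_{i₁,…,i_m} + min_{(i_j)_{j≠k}} Σ_{i_k ∉ V} A^k_{i₁,…,i_m} ]. Then the game has a unique Nash equilibrium. -/
open Finset

/-- Player's payoff in an `m`-player unit-sphere game. -/
def tensorPayoff {m : ℕ} {n : Fin m → ℕ} (T : (∀ j, Fin (n j)) → ℝ)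
    (x : ∀ j, Fin (n j) → ℝ) : ℝ :=
  ∑ i : ∀ j, Fin (n j), T i * ∏ j, x j (i j)

/-- `δ_k` of a payoff tensor `T` of player `k`: the minimum over subsets
`V ⊆ [n_k]` of `min_{(i_j)_{j≠k}} Σ_{i_k ∈ V} T + min_{(i_j)_{j≠k}} Σ_{i_k ∉ V} T`. -/
noncomputable def tensorDelta {m : ℕ} {n : Fin m → ℕ}
    (T : (∀ j, Fin (n j)) → ℝ) (k : Fin m) : ℝ :=
  sInf (Set.range fun V : Finset (Fin (n k)) =>
    sInf (Set.range fun i : ∀ j, Fin (n j) =>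
      ∑ b ∈ V, T (Function.update i k b)) +
    sInf (Set.range fun i : ∀ j, Fin (n j) =>
      ∑ b ∈ Vᶜ, T (Function.update i k b)))

/-- The vector `b ↦ ∑ᵢ T (i with i_k := b) ∏ⱼ x_j(i_j)`: the gradient of the multilinear payoff of
`T` in the strategy of player `k`, multiplied by the coordinate sum of `x k`. -/
def fiberMap {m : ℕ} {n : Fin m → ℕ} (T : (∀ j, Fin (n j)) → ℝ) (k : Fin m)
    (x : ∀ j, Fin (n j) → ℝ) (b : Fin (n k)) : ℝ :=
  ∑ i : ∀ j, Fin (n j), T (Function.update i k b) * ∏ j, x j (i j)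

lemma prod_update_apply {ι : Type*} [Fintype ι] [DecidableEq ι] {α : ι → Type*}
    (x : ∀ j, α j → ℝ) (k : ι) (p : α k → ℝ) (i : ∀ j, α j) :
    ∏ j, Function.update x k p j (i j) = p (i k) * ∏ j ∈ univ.erase k, x j (i j) := by
  rw [← Finset.mul_prod_erase univ _ (mem_univ k)]
  congr 1
  · simp
  · refine prod_congr rfl fun j hj => ?_
    rw [Function.update_of_ne (ne_of_mem_erase hj)]

section ProductMeasures

variable {ι : Type*} [Fintype ι] [DecidableEq ι] {α : ι → Type*} [∀ j, Fintype (α j)]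

lemma sum_pi_prod_eq_one {x : ∀ j, α j → ℝ} (hx : ∀ j, ∑ a, x j a = 1) :
    ∑ i : ∀ j, α j, ∏ j, x j (i j) = 1 := by
  rw [← Fintype.prod_sum]
  simp [hx]

/-- Changing one marginal of a product distribution moves it by the `ℓ¹` distance of the
marginals. -/
lemma sum_abs_prod_update_sub {x : ∀ j, α j → ℝ} (hx0 : ∀ j a, 0 ≤ x j a)
    (hx : ∀ j, ∑ a, x j a = 1) (k : ι) (p q : α k → ℝ) :
    ∑ i : ∀ j, α j, |∏ j, Function.update x k p j (i j) - ∏ j, Function.update x k q j (i j)|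
      = ∑ a, |p a - q a| := by
  have h : ∀ i : ∀ j, α j,
      |∏ j, Function.update x k p j (i j) - ∏ j, Function.update x k q j (i j)|
        = ∏ j, Function.update x k (fun a => |p a - q a|) j (i j) := fun i => by
    rw [prod_update_apply, prod_update_apply, prod_update_apply, ← sub_mul, abs_mul,
      abs_of_nonneg (prod_nonneg fun j _ => hx0 j _)]
  simp_rw [h]
  rw [← Fintype.prod_sum, ← Finset.mul_prod_erase univ _ (mem_univ k),
    Finset.prod_eq_one, mul_one]
  · simp
  · intro j hj
    simp [Function.update_of_ne (ne_of_mem_erase hj), hx]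

/-- The `ℓ¹` distance of product distributions is at most the sum over the marginals on which they
may differ. -/
lemma sum_abs_prod_piecewise_sub_le {x y : ∀ j, α j → ℝ} (hx0 : ∀ j a, 0 ≤ x j a)
    (hx : ∀ j, ∑ a, x j a = 1) (hy0 : ∀ j a, 0 ≤ y j a) (hy : ∀ j, ∑ a, y j a = 1)
    (S : Finset ι) :
    ∑ i : ∀ j, α j, |∏ j, S.piecewise x y j (i j) - ∏ j, y j (i j)|
      ≤ ∑ j ∈ S, ∑ a, |x j a - y j a| := by
  induction S using Finset.induction_on with
  | empty => simp
  | insert k S hk ih =>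
    have hz0 : ∀ j a, 0 ≤ S.piecewise x y j a := fun j a => by
      by_cases hj : j ∈ S <;> simp [hj, hx0, hy0]
    have hz : ∀ j, ∑ a, S.piecewise x y j a = 1 := fun j => by
      by_cases hj : j ∈ S <;> simp [hj, hx, hy]
    have hstep := sum_abs_prod_update_sub hz0 hz k (x k) (y k)
    have hyk : Function.update (S.piecewise x y) k (y k) = S.piecewise x y := by
      rw [Function.update_eq_self_iff]
      simp [hk]
    rw [hyk] at hstep
    rw [sum_insert hk, piecewise_insert, ← hstep]
    refine le_trans ?_ (add_le_add_right ih _)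
    rw [← sum_add_distrib]
    exact sum_le_sum fun i _ => abs_sub_le _ _ _

end ProductMeasures

/-- A signed measure of mass zero integrates `f` to at most half the oscillation of `f` times its
total mass. -/
lemma two_mul_sum_mul_le_of_sum_eq_zero {ι : Type*} [Fintype ι] {w f : ι → ℝ} {c : ℝ}
    (hw : ∑ i, w i = 0) (hf : ∀ i i', f i - f i' ≤ c) :
    2 * ∑ i, w i * f i ≤ c * ∑ i, |w i| := by
  cases isEmpty_or_nonempty ι
  · simp
  obtain ⟨i₀, h₀⟩ := Finite.exists_min f
  obtain ⟨i₁, h₁⟩ := Finite.exists_max f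
  have hcenter : 2 * ∑ i, w i * f i = ∑ i, w i * (2 * f i - (f i₀ + f i₁)) := by
    simp_rw [mul_sub, sum_sub_distrib, ← sum_mul, hw, mul_sum]
    rw [zero_mul, sub_zero]
    exact sum_congr rfl fun i _ => by ring
  rw [hcenter, mul_sum]
  refine sum_le_sum fun i _ => ?_
  have h : |2 * f i - (f i₀ + f i₁)| ≤ c := by
    rw [abs_le]
    constructor <;> linarith [h₀ i, h₁ i, hf i₁ i₀]
  calc w i * (2 * f i - (f i₀ + f i₁)) ≤ |w i| * |2 * f i - (f i₀ + f i₁)| := by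
        rw [← abs_mul]; exact le_abs_self _
    _ ≤ |w i| * c := mul_le_mul_of_nonneg_left h (abs_nonneg _)
    _ = c * |w i| := mul_comm _ _

/-- The `ℓ¹` norm of a vector with coordinate sum zero is twice the mass of its positive part. -/
lemma sum_abs_eq_two_mul_sum_filter_pos {β : Type*} [Fintype β] {u : β → ℝ}
    (hu : ∑ b, u b = 0) : ∑ b, |u b| = 2 * ∑ b ∈ univ.filter (fun b => 0 < u b), u b := by
  have h : ∀ b, |u b| = 2 * (if 0 < u b then u b else 0) - u b := fun b => by
    split_ifs with hb
    · rw [abs_of_pos hb]; ring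
    · rw [abs_of_nonpos (not_lt.1 hb)]; ring
  simp_rw [h, sum_sub_distrib, hu, sub_zero, ← mul_sum, sum_filter]

section FiberMap

variable {m : ℕ} {n : Fin m → ℕ}

lemma tensorDelta_le {T : (∀ j, Fin (n j)) → ℝ} {k : Fin m} (V : Finset (Fin (n k)))
    (i i' : ∀ j, Fin (n j)) :
    tensorDelta T k ≤
      ∑ b ∈ V, T (Function.update i k b) + ∑ b ∈ Vᶜ, T (Function.update i' k b) := by
  refine (csInf_le (Set.finite_range _).bddBelow ⟨V, rfl⟩).trans (add_le_add ?_ ?_)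
  · exact csInf_le (Set.finite_range _).bddBelow ⟨i, rfl⟩
  · exact csInf_le (Set.finite_range _).bddBelow ⟨i', rfl⟩

lemma sum_fiber_sub_le {T : (∀ j, Fin (n j)) → ℝ} {k : Fin m}
    (hT : ∀ i : ∀ j, Fin (n j), ∑ b : Fin (n k), T (Function.update i k b) = 1)
    (V : Finset (Fin (n k))) (i i' : ∀ j, Fin (n j)) :
    ∑ b ∈ V, T (Function.update i k b) - ∑ b ∈ V, T (Function.update i' k b)
      ≤ 1 - tensorDelta T k := by
  have h₁ := tensorDelta_le (T := T) V i' i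
  have h₂ := sum_add_sum_compl V fun b => T (Function.update i k b)
  rw [hT i] at h₂
  linarith

/-- The mass of `fiberMap T k x` when `T` has fiber sums one. -/
lemma sum_fiberMap {T : (∀ j, Fin (n j)) → ℝ} {k : Fin m}
    (hT : ∀ i : ∀ j, Fin (n j), ∑ b : Fin (n k), T (Function.update i k b) = 1)
    (x : ∀ j, Fin (n j) → ℝ) : ∑ b, fiberMap T k x b = ∏ j, ∑ a, x j a := by
  unfold fiberMap
  rw [sum_comm, Fintype.prod_sum]
  refine sum_congr rfl fun i _ => ?_
  rw [← sum_mul, hT, one_mul]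

/-- Moving the sum over the `k`-th coordinate: `fiberMap` is the gradient of the payoff in the
strategy of player `k`, up to the factor `∑ a, x k a`. -/
lemma tensorPayoff_update_mul_sum (T : (∀ j, Fin (n j)) → ℝ) (k : Fin m)
    (x : ∀ j, Fin (n j) → ℝ) (z : Fin (n k) → ℝ) :
    tensorPayoff T (Function.update x k z) * ∑ a, x k a = ∑ b, z b * fiberMap T k x b := by
  unfold tensorPayoff fiberMap
  simp_rw [mul_sum, sum_mul]
  rw [← Fintype.sum_prod_type', ← Fintype.sum_prod_type']
  have hswap : Function.Involutive
      fun p : Fin (n k) × (∀ j, Fin (n j)) => (p.2 k, Function.update p.2 k p.1) :=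
    fun p => by simp
  refine Fintype.sum_equiv (hswap.toPerm _) _ _ fun p => ?_
  obtain ⟨a, i⟩ := p
  simp only [Function.Involutive.coe_toPerm, Function.update_idem, Function.update_eq_self]
  rw [prod_update_apply, ← Finset.mul_prod_erase univ _ (mem_univ k), Function.update_self]
  have h : ∏ j ∈ univ.erase k, x j (Function.update i k a j)
      = ∏ j ∈ univ.erase k, x j (i j) :=
    prod_congr rfl fun j hj => by rw [Function.update_of_ne (ne_of_mem_erase hj)]
  rw [h]
  ring

/-- `fiberMap` depends on the strategy of player `k` only through its coordinate sum. -/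
lemma fiberMap_update_self (T : (∀ j, Fin (n j)) → ℝ) (k : Fin m)
    (x : ∀ j, Fin (n j) → ℝ) {p : Fin (n k) → ℝ} (hx : ∑ a, x k a = 1) (hp : ∑ a, p a = 1) :
    fiberMap T k (Function.update x k p) = fiberMap T k x := by
  funext b
  have h₁ := tensorPayoff_update_mul_sum T k x (Pi.single b 1)
  have h₂ := tensorPayoff_update_mul_sum T k (Function.update x k p) (Pi.single b 1)
  simp only [Function.update_idem, Function.update_self, hx, hp, mul_one, Pi.single_apply,
    ite_mul, one_mul, zero_mul, sum_ite_eq', mem_univ, if_true] at h₁ h₂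
  rw [← h₁, ← h₂]

lemma fiberMap_smul (T : (∀ j, Fin (n j)) → ℝ) (k : Fin m) (x : ∀ j, Fin (n j) → ℝ)
    (c : Fin m → ℝ) (b : Fin (n k)) :
    fiberMap T k (fun j a => c j * x j a) b = (∏ j, c j) * fiberMap T k x b := by
  unfold fiberMap
  rw [mul_sum]
  exact sum_congr rfl fun i _ => by rw [prod_mul_distrib]; ring

lemma fiberMap_nonneg {T : (∀ j, Fin (n j)) → ℝ} (hT : ∀ i, 0 < T i) {k : Fin m}
    {x : ∀ j, Fin (n j) → ℝ} (hx : ∀ j a, 0 ≤ x j a) (b : Fin (n k)) :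
    0 ≤ fiberMap T k x b :=
  sum_nonneg fun _ _ => mul_nonneg (hT _).le (prod_nonneg fun j _ => hx j _)

lemma continuous_fiberMap (T : (∀ j, Fin (n j)) → ℝ) (k : Fin m) (b : Fin (n k)) :
    Continuous fun x : ∀ j, Fin (n j) → ℝ => fiberMap T k x b := by
  unfold fiberMap
  fun_prop

/-- Dobrushin contraction for `fiberMap`. -/
lemma sum_abs_fiberMap_sub_le {T : (∀ j, Fin (n j)) → ℝ} {k : Fin m}
    (hT : ∀ i : ∀ j, Fin (n j), ∑ b : Fin (n k), T (Function.update i k b) = 1)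
    (hδ : tensorDelta T k ≤ 1)
    {x y : ∀ j, Fin (n j) → ℝ} (hx0 : ∀ j a, 0 ≤ x j a) (hx : ∀ j, ∑ a, x j a = 1)
    (hy0 : ∀ j a, 0 ≤ y j a) (hy : ∀ j, ∑ a, y j a = 1) :
    ∑ b, |fiberMap T k x b - fiberMap T k y b|
      ≤ (1 - tensorDelta T k) * ∑ j ∈ univ.erase k, ∑ a, |x j a - y j a| := by
  set z : ∀ j, Fin (n j) → ℝ := (univ.erase k).piecewise x y with hz
  have hz1 : ∀ j, ∑ a, z j a = 1 := fun j => by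
    by_cases hj : j = k
    · subst hj; simp [hz, hy]
    · simp [hz, hj, hx]
  have hxz : fiberMap T k x = fiberMap T k z := by
    rw [← fiberMap_update_self T k z (hz1 k) (hx k)]
    congr 1
    funext j
    by_cases hj : j = k
    · subst hj; simp
    · simp [hz, hj]
  rw [hxz]
  have hsum : ∑ b, (fiberMap T k z b - fiberMap T k y b) = 0 := by
    rw [sum_sub_distrib, sum_fiberMap hT, sum_fiberMap hT]
    simp [hz1, hy]
  rw [sum_abs_eq_two_mul_sum_filter_pos hsum]
  generalize univ.filter (fun b => 0 < fiberMap T k z b - fiberMap T k y b) = V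
  have hV : ∑ b ∈ V, (fiberMap T k z b - fiberMap T k y b)
      = ∑ i : ∀ j, Fin (n j), (∏ j, z j (i j) - ∏ j, y j (i j)) *
          ∑ b ∈ V, T (Function.update i k b) := by
    unfold fiberMap
    simp_rw [← sum_sub_distrib, mul_sum]
    rw [sum_comm]
    exact sum_congr rfl fun i _ => sum_congr rfl fun b _ => by ring
  rw [hV]
  refine (two_mul_sum_mul_le_of_sum_eq_zero ?_ fun i i' => sum_fiber_sub_le hT V i i').trans
    (mul_le_mul_of_nonneg_left (sum_abs_prod_piecewise_sub_le hx0 hx hy0 hy _) (by linarith))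
  rw [sum_sub_distrib, sum_pi_prod_eq_one hz1, sum_pi_prod_eq_one hy, sub_self]

/-- Under the `δ` condition the profile map `fiberMap` strictly decreases total `ℓ¹` distances
of profiles of probability vectors. -/
lemma sum_sum_abs_fiberMap_sub_lt (hm : 2 ≤ m) (hn : ∀ k, 0 < n k)
    {A : ∀ _ : Fin m, (∀ j, Fin (n j)) → ℝ}
    (hMarkov : ∀ (k : Fin m) (i : ∀ j, Fin (n j)),
      ∑ b : Fin (n k), A k (Function.update i k b) = 1)
    (hdelta : ∀ k, ((m : ℝ) - 2) / ((m : ℝ) - 1) < tensorDelta (A k) k)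
    {x y : ∀ j, Fin (n j) → ℝ} (hx0 : ∀ j a, 0 ≤ x j a) (hx : ∀ j, ∑ a, x j a = 1)
    (hy0 : ∀ j a, 0 ≤ y j a) (hy : ∀ j, ∑ a, y j a = 1) (hxy : x ≠ y) :
    ∑ k, ∑ b, |fiberMap (A k) k x b - fiberMap (A k) k y b| < ∑ k, ∑ b, |x k b - y k b| := by
  have hm1 : (0 : ℝ) < m - 1 := by
    have : (2 : ℝ) ≤ m := by exact_mod_cast hm
    linarith
  set d : Fin m → ℝ := fun j => ∑ a, |x j a - y j a| with hd
  have hd0 : ∀ j, 0 ≤ d j := fun j => sum_nonneg fun _ _ => abs_nonneg _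
  have hcoef : ∀ k, 1 - tensorDelta (A k) k < 1 / ((m : ℝ) - 1) := fun k => by
    have h := hdelta k
    have e : ((m : ℝ) - 2) / ((m : ℝ) - 1) = 1 - 1 / ((m : ℝ) - 1) := by
      field_simp; ring
    linarith
  have hδ : ∀ k, tensorDelta (A k) k ≤ 1 := fun k => by
    have h := tensorDelta_le (T := A k) (k := k) univ (fun j => ⟨0, hn j⟩) (fun j => ⟨0, hn j⟩)
    simpa [hMarkov] using h
  have htotal : ∑ k, ∑ j ∈ univ.erase k, d j = ((m : ℝ) - 1) * ∑ j, d j := by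
    have h : ∀ k : Fin m, ∑ j ∈ univ.erase k, d j = ∑ j, d j - d k := fun k => by
      rw [← Finset.add_sum_erase univ d (mem_univ k)]; ring
    simp_rw [h, sum_sub_distrib, sum_const, card_univ, Fintype.card_fin, nsmul_eq_mul]
    ring
  have hpos : 0 < ∑ j, d j := by
    obtain ⟨j, hj⟩ := Function.ne_iff.1 hxy
    obtain ⟨a, ha⟩ := Function.ne_iff.1 hj
    refine sum_pos' (fun j _ => hd0 j) ⟨j, mem_univ _, ?_⟩
    exact sum_pos' (fun _ _ => abs_nonneg _) ⟨a, mem_univ _, abs_pos.2 (sub_ne_zero.2 ha)⟩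
  obtain ⟨k₀, -, hk₀⟩ : ∃ k ∈ univ, 0 < ∑ j ∈ univ.erase k, d j := by
    refine exists_lt_of_sum_lt (f := fun _ => (0 : ℝ)) ?_
    rw [htotal, sum_const_zero]
    exact mul_pos hm1 hpos
  have hcontr := fun k => sum_abs_fiberMap_sub_le (hMarkov k) (hδ k) hx0 hx hy0 hy
  calc ∑ k, ∑ b, |fiberMap (A k) k x b - fiberMap (A k) k y b|
      < ∑ k, 1 / ((m : ℝ) - 1) * ∑ j ∈ univ.erase k, d j := by
        refine sum_lt_sum (fun k _ => (hcontr k).trans ?_) ⟨k₀, mem_univ _, (hcontr k₀).trans_lt ?_⟩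
        · exact mul_le_mul_of_nonneg_right (hcoef k).le (sum_nonneg fun j _ => hd0 j)
        · exact mul_lt_mul_of_pos_right (hcoef k₀) hk₀
    _ = ∑ k, d k := by
        rw [← mul_sum, htotal]
        field_simp

/-- The profile map `fiberMap` has a fixed point among profiles of probability vectors. -/
lemma exists_fiberMap_eq_self (hm : 2 ≤ m) (hn : ∀ k, 0 < n k)
    {A : ∀ _ : Fin m, (∀ j, Fin (n j)) → ℝ} (hA : ∀ k i, 0 < A k i)
    (hMarkov : ∀ (k : Fin m) (i : ∀ j, Fin (n j)),
      ∑ b : Fin (n k), A k (Function.update i k b) = 1)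
    (hdelta : ∀ k, ((m : ℝ) - 2) / ((m : ℝ) - 1) < tensorDelta (A k) k) :
    ∃ y : ∀ j, Fin (n j) → ℝ, (∀ j a, 0 ≤ y j a) ∧ (∀ j, ∑ a, y j a = 1) ∧
      ∀ k, fiberMap (A k) k y = y k := by
  let K : Set (∀ j, Fin (n j) → ℝ) := Set.univ.pi fun j => stdSimplex ℝ (Fin (n j))
  have hK : IsCompact K := isCompact_univ_pi fun j => isCompact_stdSimplex ℝ (Fin (n j))
  have hne : K.Nonempty := Set.univ_pi_nonempty_iff.2 fun j =>
    ⟨_, single_mem_stdSimplex ℝ (⟨0, hn j⟩ : Fin (n j))⟩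
  have hcont : Continuous fun y : ∀ j, Fin (n j) → ℝ =>
      ∑ k, ∑ b, |fiberMap (A k) k y b - y k b| := by
    have := fun k b => continuous_fiberMap (A k) k b
    fun_prop
  obtain ⟨y, hy, hmin⟩ := hK.exists_isMinOn hne hcont.continuousOn
  have hy0 : ∀ j a, 0 ≤ y j a := fun j => (hy j trivial).1
  have hy1 : ∀ j, ∑ a, y j a = 1 := fun j => (hy j trivial).2
  refine ⟨y, hy0, hy1, ?_⟩
  by_contra hfix
  have hF0 : ∀ k b, 0 ≤ fiberMap (A k) k y b := fun k b => fiberMap_nonneg (hA k) hy0 b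
  have hF1 : ∀ k, ∑ b, fiberMap (A k) k y b = 1 := fun k => by
    rw [sum_fiberMap (hMarkov k)]; simp [hy1]
  have hlt := sum_sum_abs_fiberMap_sub_lt hm hn hMarkov hdelta hF0 hF1 hy0 hy1
    fun h => hfix fun k => congrFun h k
  exact absurd (hmin (show (fun k => fiberMap (A k) k y) ∈ K from fun k _ => ⟨hF0 k, hF1 k⟩))
    (not_le.2 hlt)

end FiberMap

lemma sum_pos_of_sum_sq_eq_one {β : Type*} [Fintype β] {x : β → ℝ} (hx0 : ∀ b, 0 ≤ x b)
    (hx : ∑ b, x b ^ 2 = 1) : 0 < ∑ b, x b := by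
  refine lt_of_le_of_ne (sum_nonneg fun b _ => hx0 b) fun h => ?_
  have h0 := (sum_eq_zero_iff_of_nonneg fun b _ => hx0 b).1 h.symm
  simp [fun b => h0 b (mem_univ b)] at hx

/-- A maximiser of a nonzero nonnegative linear functional over the nonnegative unit sphere is the
normalisation of that functional. -/
lemma exists_mul_eq_of_forall_sum_mul_le {β : Type*} [Fintype β] {x g : β → ℝ}
    (hx : ∑ b, x b ^ 2 = 1) (hg0 : ∀ b, 0 ≤ g b) (hg : 0 < ∑ b, g b)
    (hmax : ∀ z : β → ℝ, (∀ b, 0 ≤ z b) → ∑ b, z b ^ 2 = 1 →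
      ∑ b, z b * g b ≤ ∑ b, x b * g b) :
    ∃ r : ℝ, ∀ b, g b = r * x b := by
  have hsq : 0 < ∑ b, g b ^ 2 := by
    obtain ⟨b, -, hb⟩ : ∃ b ∈ univ, 0 < g b :=
      exists_lt_of_sum_lt (f := fun _ => (0 : ℝ)) (by simpa using hg)
    exact sum_pos' (fun _ _ => sq_nonneg _) ⟨b, mem_univ _, by positivity⟩
  obtain ⟨r, hr, hrsq⟩ : ∃ r : ℝ, 0 < r ∧ r ^ 2 = ∑ b, g b ^ 2 :=
    ⟨_, Real.sqrt_pos.2 hsq, Real.sq_sqrt hsq.le⟩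
  have h := hmax (fun b => g b / r) (fun b => div_nonneg (hg0 b) hr.le) (by
    simp_rw [div_pow]
    rw [← sum_div, hrsq, div_self hsq.ne'])
  have hr' : ∑ b, g b / r * g b = r := by
    have e : ∀ b, g b / r * g b = g b ^ 2 / r := fun b => by ring
    simp_rw [e]
    rw [← sum_div, ← hrsq]
    field_simp
  rw [hr'] at h
  have hdist : ∑ b, (g b - r * x b) ^ 2 ≤ 0 := by
    have e : ∀ b, (g b - r * x b) ^ 2 = g b ^ 2 - 2 * r * (x b * g b) + r ^ 2 * x b ^ 2 :=
      fun b => by ring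
    simp_rw [e, sum_add_distrib, sum_sub_distrib, ← mul_sum, hx, ← hrsq]
    nlinarith
  have hzero := (sum_eq_zero_iff_of_nonneg fun b _ => sq_nonneg (g b - r * x b)).1
    (le_antisymm hdist (sum_nonneg fun _ _ => sq_nonneg _))
  exact ⟨r, fun b => sub_eq_zero.1 (pow_eq_zero_iff two_ne_zero |>.1 (hzero b (mem_univ b)))⟩

/-- The `ℓ¹` normalisation of an equilibrium is fixed by the profile map `fiberMap`. -/
lemma fiberMap_normalize_eq_of_isNash {m : ℕ} {n : Fin m → ℕ}
    {A : ∀ _ : Fin m, (∀ j, Fin (n j)) → ℝ} (hA : ∀ k i, 0 < A k i)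
    (hMarkov : ∀ (k : Fin m) (i : ∀ j, Fin (n j)),
      ∑ b : Fin (n k), A k (Function.update i k b) = 1)
    {x : ∀ k, Fin (n k) → ℝ} (hx0 : ∀ k i, 0 ≤ x k i) (hx : ∀ k, ∑ i, x k i ^ 2 = 1)
    (hNash : ∀ k, ∀ z : Fin (n k) → ℝ, (∀ i, 0 ≤ z i) → ∑ i, z i ^ 2 = 1 →
      tensorPayoff (A k) (Function.update x k z) ≤ tensorPayoff (A k) x) (k : Fin m) :
    fiberMap (A k) k (fun j a => (∑ c, x j c)⁻¹ * x j a)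
      = fun a => (∑ c, x k c)⁻¹ * x k a := by
  have hs : ∀ j, 0 < ∑ c, x j c := fun j => sum_pos_of_sum_sq_eq_one (hx0 j) (hx j)
  have hsum := sum_fiberMap (hMarkov k) x
  have hP : 0 < ∏ j, ∑ c, x j c := prod_pos fun j _ => hs j
  obtain ⟨r, hr⟩ := exists_mul_eq_of_forall_sum_mul_le (hx k)
    (fiberMap_nonneg (hA k) hx0) (hsum ▸ hP) fun z hz0 hz => by
      rw [← tensorPayoff_update_mul_sum, ← tensorPayoff_update_mul_sum, Function.update_eq_self]
      exact mul_le_mul_of_nonneg_right (hNash k z hz0 hz) (hs k).le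
  simp_rw [hr] at hsum
  rw [← mul_sum] at hsum
  funext b
  rw [fiberMap_smul, hr, prod_inv_distrib, ← hsum]
  have hr0 : r ≠ 0 := by
    rintro rfl
    simp [← hsum] at hP
  have := (hs k).ne'
  field_simp

/-- a normalized Markov `m`-player positive unit-sphere game
(`m ≥ 2`) with `δ_k > (m−2)/(m−1)` for every player `k` has a unique Nash
equilibrium. -/
theorem markov_pusg_unique_ne {m : ℕ} (hm : 2 ≤ m) {n : Fin m → ℕ}
    (hn : ∀ k, 0 < n k)
    (A : ∀ _ : Fin m, (∀ j, Fin (n j)) → ℝ)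
    (hA : ∀ k i, 0 < A k i)
    (hMarkov : ∀ (k : Fin m) (i : ∀ j, Fin (n j)),
      ∑ b : Fin (n k), A k (Function.update i k b) = 1)
    (hdelta : ∀ k, ((m : ℝ) - 2) / ((m : ℝ) - 1) < tensorDelta (A k) k) :
    ∃! x : ∀ k, Fin (n k) → ℝ,
      (∀ k i, 0 ≤ x k i) ∧ (∀ k, ∑ i, x k i ^ 2 = 1) ∧
      (∀ k, ∀ z : Fin (n k) → ℝ, (∀ i, 0 ≤ z i) → ∑ i, z i ^ 2 = 1 →
        tensorPayoff (A k) (Function.update x k z) ≤ tensorPayoff (A k) x) := by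
  obtain ⟨y, hy0, hy1, hfix⟩ := exists_fiberMap_eq_self hm hn hA hMarkov hdelta
  have hsq : ∀ k, 0 < ∑ a, y k a ^ 2 := fun k => by
    obtain ⟨a, -, ha⟩ : ∃ a ∈ univ, 0 < y k a :=
      exists_lt_of_sum_lt (f := fun _ => (0 : ℝ)) (by simp [hy1])
    exact sum_pos' (fun _ _ => sq_nonneg _) ⟨a, mem_univ _, by positivity⟩
  have hc : ∀ k, ∃ c : ℝ, 0 < c ∧ c ^ 2 * ∑ a, y k a ^ 2 = 1 := fun k =>
    ⟨(√(∑ a, y k a ^ 2))⁻¹, inv_pos.2 (Real.sqrt_pos.2 (hsq k)), by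
      rw [inv_pow, Real.sq_sqrt (hsq k).le, inv_mul_cancel₀ (hsq k).ne']⟩
  choose c hc0 hc1 using hc
  have hunit : ∀ k, ∑ a, (c k * y k a) ^ 2 = 1 := fun k => by
    simp_rw [mul_pow, ← mul_sum, hc1]
  refine ⟨fun k a => c k * y k a, ⟨fun k a => mul_nonneg (hc0 k).le (hy0 k a), hunit, ?_⟩, ?_⟩
  · intro k z hz0 hz
    have hs : 0 < ∑ a, c k * y k a := by rw [← mul_sum, hy1, mul_one]; exact hc0 k
    refine le_of_mul_le_mul_right ?_ hs
    have hself := tensorPayoff_update_mul_sum (A k) k (fun k a => c k * y k a)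
      (fun a => c k * y k a)
    have hz' := tensorPayoff_update_mul_sum (A k) k (fun k a => c k * y k a) z
    rw [Function.update_eq_self] at hself
    rw [hself, hz']
    simp_rw [fiberMap_smul, hfix]
    have hP : 0 < ∏ j, c j := prod_pos fun j _ => hc0 j
    have hck := hc0 k
    have hcs : ∑ b, z b * (c k * y k b) ≤ 1 := by
      calc ∑ b, z b * (c k * y k b) ≤ ∑ b, (z b ^ 2 + (c k * y k b) ^ 2) / 2 :=
            sum_le_sum fun b _ => by nlinarith [sq_nonneg (z b - c k * y k b)]
        _ = 1 := by rw [← sum_div, sum_add_distrib, hz, hunit]; norm_num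
    have e : ∀ u : Fin (n k) → ℝ, ∑ b, u b * ((∏ j, c j) * y k b)
        = (∏ j, c j) / c k * ∑ b, u b * (c k * y k b) := fun u => by
      rw [mul_sum]
      exact sum_congr rfl fun b _ => by field_simp
    rw [e z, e fun b => c k * y k b]
    refine mul_le_mul_of_nonneg_left ?_ (by positivity)
    simpa only [← sq, hunit] using hcs
  · rintro x ⟨hx0, hx, hNash⟩
    have hs : ∀ j, 0 < ∑ a, x j a := fun j => sum_pos_of_sum_sq_eq_one (hx0 j) (hx j)
    have hxfix := fiberMap_normalize_eq_of_isNash hA hMarkov hx0 hx hNash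
    have hxy : (fun j a => (∑ b, x j b)⁻¹ * x j a) = y := by
      by_contra hne
      have hlt := sum_sum_abs_fiberMap_sub_lt hm hn hMarkov hdelta
        (fun j a => mul_nonneg (inv_nonneg.2 (hs j).le) (hx0 j a))
        (fun j => by rw [← mul_sum, inv_mul_cancel₀ (hs j).ne']) hy0 hy1 hne
      simp_rw [hxfix, hfix] at hlt
      exact lt_irrefl _ hlt
    funext k a
    have hscale : ∀ b, x k b = (∑ d, x k d) * y k b := fun b => by
      rw [← hxy, mul_inv_cancel_left₀ (hs k).ne']
    have hnorm : (∑ d, x k d) ^ 2 * ∑ b, y k b ^ 2 = 1 := by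
      rw [mul_sum, ← hx k]
      exact sum_congr rfl fun b _ => by rw [← mul_pow, ← hscale]
    have hck : ∑ d, x k d = c k :=
      (pow_left_inj₀ (hs k).le (hc0 k).le two_ne_zero).1
        (mul_right_cancel₀ (hsq k).ne' (hnorm.trans (hc1 k).symm))
    rw [hscale, hck]
end
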